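/- arXiv:math/0510536 — 5 statements merged into one kernel-verified Lean document; each statement's English description precedes it below -/
import Mathlib

section
/- Let G be a connected finite simple graph on n ≥ 1 vertices. Then there exist nonnegative integers h_0, h_1, …, h_{n-1} with h_0 = 1 such that for every natural number k, the number of proper k-colorings of G satisfies (as integers) P(G,k) = Σ_{i=0}^{n-1} (-1)^i · h_i · k · (k-1)^{n-1-i}. -/
/-- The number of proper `k`-colorings of a simple graph `G`: functions from the
vertices to `Fin k` such that adjacent vertices receive distinct colors. -/
noncomputable def properColoringCount {V : Type*} (G : SimpleGraph V) (k : ℕ) : ℕ :=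
  Nat.card {f : V → Fin k // ∀ a b, G.Adj a b → f a ≠ f b}

/-- The sequence `P` has an expansion `P k = ∑ i < n, (-1)^i h i k (k-1)^(n-1-i)` with natural
coefficients `h i` and `h 0 = 1`. -/
def HasHExpansion (P : ℕ → ℤ) (n : ℕ) : Prop :=
  ∃ h : ℕ → ℕ, h 0 = 1 ∧ ∀ k : ℕ, P k =
    ∑ i ∈ Finset.range n, (-1 : ℤ) ^ i * (h i : ℤ) * (k : ℤ) * ((k : ℤ) - 1) ^ (n - 1 - i)

theorem HasHExpansion.sub_one_mul {P : ℕ → ℤ} {n : ℕ} (hn : 1 ≤ n) (hP : HasHExpansion P n) :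
    HasHExpansion (fun k => ((k : ℤ) - 1) * P k) (n + 1) := by
  obtain ⟨h, h0, hP⟩ := hP
  refine ⟨fun i => if i < n then h i else 0, by simp [h0, show 0 < n from hn], fun k => ?_⟩
  simp only [hP, Finset.sum_range_succ, lt_irrefl, if_false, Nat.cast_zero, mul_zero, zero_mul,
    add_zero, Finset.mul_sum]
  refine Finset.sum_congr rfl fun i hi => ?_
  have hi := Finset.mem_range.mp hi
  rw [if_pos hi, show n + 1 - 1 - i = (n - 1 - i) + 1 by omega, pow_succ]
  ring

theorem HasHExpansion.sub {P Q : ℕ → ℤ} {n : ℕ} (hP : HasHExpansion P (n + 1))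
    (hQ : HasHExpansion Q n) : HasHExpansion (fun k => P k - Q k) (n + 1) := by
  obtain ⟨h, h0, hP⟩ := hP
  obtain ⟨q, -, hQ⟩ := hQ
  refine ⟨fun i => h i + if i = 0 then 0 else q (i - 1), by simp [h0], fun k => ?_⟩
  simp only [hP, hQ, Finset.sum_range_succ' _ n, add_sub_right_comm, ← Finset.sum_sub_distrib]
  congr 1
  · refine Finset.sum_congr rfl fun i hi => ?_
    rw [if_neg i.succ_ne_zero, show n + 1 - 1 - (i + 1) = n - 1 - i by omega]
    push_cast
    ring

/-- The number of proper `k`-colorings of the graph obtained from `H` by adding one vertex with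
neighborhood `S`. -/
noncomputable def extendedColoringCount {W : Type*} (H : SimpleGraph W) (S : Set W) (k : ℕ) : ℕ :=
  Nat.card {p : Fin k × (W → Fin k) // (∀ a b, H.Adj a b → p.2 a ≠ p.2 b) ∧ ∀ s ∈ S, p.2 s ≠ p.1}

theorem extendedColoringCount_add {W : Type*} [Finite W] (H : SimpleGraph W) {S : Set W} {v : W}
    (hv : v ∉ S) (k : ℕ) :
    extendedColoringCount H (insert v S) k +
        properColoringCount (H ⊔ SimpleGraph.fromRel fun x y => x = v ∧ y ∈ S) k =
      extendedColoringCount H S k := by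
  classical
  have e : {f : W → Fin k // ∀ a b,
      (H ⊔ SimpleGraph.fromRel fun x y => x = v ∧ y ∈ S).Adj a b → f a ≠ f b} ≃
      {p : {p : Fin k × (W → Fin k) // (∀ a b, H.Adj a b → p.2 a ≠ p.2 b) ∧
        ∀ s ∈ S, p.2 s ≠ p.1} // ¬ p.1.2 v ≠ p.1.1} :=
    { toFun := fun f => ⟨⟨(f.1 v, f.1), fun a b hab => f.2 a b (Or.inl hab), fun s hs =>
        f.2 s v (Or.inr ⟨fun h => hv (h ▸ hs), Or.inr ⟨rfl, hs⟩⟩)⟩, not_not.mpr rfl⟩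
      invFun := fun p => ⟨p.1.1.2, by
        have hp := not_not.mp p.2
        rintro a b (hab | ⟨-, ⟨rfl, hb⟩ | ⟨rfl, ha⟩⟩)
        · exact p.1.2.1 a b hab
        · exact fun h => p.1.2.2 b hb (h.symm.trans hp)
        · exact fun h => p.1.2.2 a ha (h.trans hp)⟩
      left_inv := fun f => rfl
      right_inv := fun p => by
        have hp := not_not.mp p.2
        exact Subtype.ext (Subtype.ext (Prod.ext hp rfl)) }
  have e' : {p : Fin k × (W → Fin k) // (∀ a b, H.Adj a b → p.2 a ≠ p.2 b) ∧
        ∀ s ∈ insert v S, p.2 s ≠ p.1} ≃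
      {p : {p : Fin k × (W → Fin k) // (∀ a b, H.Adj a b → p.2 a ≠ p.2 b) ∧
        ∀ s ∈ S, p.2 s ≠ p.1} // p.1.2 v ≠ p.1.1} :=
    (Equiv.subtypeEquivRight fun p => by
      rw [Set.forall_mem_insert, and_assoc, and_comm (a := p.2 v ≠ p.1)]).trans
      (Equiv.subtypeSubtypeEquivSubtypeInter _ fun p : Fin k × (W → Fin k) => p.2 v ≠ p.1).symm
  rw [extendedColoringCount, properColoringCount, Nat.card_congr e, Nat.card_congr e',
    ← Nat.card_sum, Nat.card_congr (Equiv.sumCompl _), extendedColoringCount]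

theorem extendedColoringCount_singleton {W : Type*} [Finite W] (H : SimpleGraph W) (v : W)
    (k : ℕ) : (extendedColoringCount H {v} k : ℤ) = ((k : ℤ) - 1) * properColoringCount H k := by
  have hadd := extendedColoringCount_add H (Set.notMem_empty v) k
  have hempty : extendedColoringCount H ∅ k = k * properColoringCount H k := by
    have e : {p : Fin k × (W → Fin k) // (∀ a b, H.Adj a b → p.2 a ≠ p.2 b) ∧
        ∀ s ∈ (∅ : Set W), p.2 s ≠ p.1} ≃
        Fin k × {f : W → Fin k // ∀ a b, H.Adj a b → f a ≠ f b} :=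
      { toFun := fun p => (p.1.1, ⟨p.1.2, p.2.1⟩)
        invFun := fun p => ⟨(p.1, p.2.1), p.2.2, by simp⟩
        left_inv := fun p => rfl
        right_inv := fun p => rfl }
    rw [extendedColoringCount, Nat.card_congr e, Nat.card_prod, Nat.card_fin, properColoringCount]
  have hbot : (SimpleGraph.fromRel fun x y : W => x = v ∧ y ∈ (∅ : Set W)) = ⊥ := by
    ext; simp
  rw [hempty, hbot, sup_bot_eq, insert_empty_eq] at hadd
  zify at hadd
  linear_combination hadd

theorem hasHExpansion_extendedColoringCount {W : Type*} [Finite W] {n : ℕ} (hn : 1 ≤ n)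
    (hW : ∀ H : SimpleGraph W, H.Connected →
      HasHExpansion (fun k => (properColoringCount H k : ℤ)) n)
    {H : SimpleGraph W} (hH : H.Connected) {S : Set W} (hS : S.Nonempty) :
    HasHExpansion (fun k => (extendedColoringCount H S k : ℤ)) (n + 1) := by
  have hfin := S.toFinite
  induction S, hfin using Set.Finite.induction_on with
  | empty => exact (Set.not_nonempty_empty hS).elim
  | @insert v S hv _ ih =>
    obtain rfl | hS' := S.eq_empty_or_nonempty
    · simpa only [insert_empty_eq, extendedColoringCount_singleton] using
        (hW H hH).sub_one_mul hn
    · convert (ih hS').sub (hW _ (hH.mono (le_sup_left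
        (b := SimpleGraph.fromRel fun x y => x = v ∧ y ∈ S)))) using 2 with k
      rw [← extendedColoringCount_add H hv k]
      push_cast
      ring

theorem properColoringCount_eq_extendedColoringCount {V : Type*} (G : SimpleGraph V) (u : V)
    (k : ℕ) : properColoringCount G k =
      extendedColoringCount (G.induce {u}ᶜ) {x | G.Adj u x} k := by
  classical
  refine Nat.card_congr ((Equiv.funSplitAt u (Fin k)).subtypeEquiv fun f =>
    ⟨fun hf => ⟨fun a b hab => hf a b hab, fun s hs => (hf u s hs).symm⟩, ?_⟩)
  rintro ⟨h1, h2⟩ a b hab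
  by_cases ha : a = u
  · subst ha
    exact (h2 ⟨b, hab.ne'⟩ hab).symm
  by_cases hb : b = u
  · subst hb
    exact h2 ⟨a, ha⟩ hab.symm
  exact h1 ⟨a, ha⟩ ⟨b, hb⟩ hab

theorem SimpleGraph.Connected.hasHExpansion {n : ℕ} {V : Type*} [Finite V]
    {G : SimpleGraph V} (hG : G.Connected) (hn : Nat.card V = n + 1) :
    HasHExpansion (fun k => (properColoringCount G k : ℤ)) (n + 1) := by
  induction n generalizing V with
  | zero =>
    obtain ⟨hsub, ⟨v⟩⟩ := Nat.card_eq_one_iff_unique.mp hn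
    let _ : Unique V := _root_.uniqueOfSubsingleton v
    refine ⟨fun _ => 1, rfl, fun k => ?_⟩
    simp [properColoringCount]
  | succ n ih =>
    have : Nontrivial V := Finite.one_lt_card_iff_nontrivial.mp (by omega)
    obtain ⟨u, hu⟩ := hG.exists_connected_induce_compl_singleton_of_finite_nontrivial
    obtain ⟨x, hx⟩ := hG.preconnected.exists_adj_of_nontrivial u
    have hcard : Nat.card ({u}ᶜ : Set V) = n + 1 := by
      have := Set.ncard_add_ncard_compl {u}
      rw [Set.ncard_singleton, hn] at this
      rw [Nat.card_coe_set_eq]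
      omega
    simp only [properColoringCount_eq_extendedColoringCount G u]
    exact hasHExpansion_extendedColoringCount n.succ_pos (fun H hH => ih hH hcard) hu
      ⟨⟨x, hx.ne'⟩, hx⟩

/-- For a connected finite simple graph on `n ≥ 1` vertices, there are nonnegative
integers `h 0, …, h (n-1)` with `h 0 = 1` such that
`P(G,k) = ∑_{i=0}^{n-1} (-1)^i hᵢ k (k-1)^{n-1-i}` for every natural number `k`. -/
theorem h_vector_expansion {V : Type*} [Fintype V] (G : SimpleGraph V)
    (hG : G.Connected) (n : ℕ) (hn : n = Fintype.card V) (hn1 : 1 ≤ n) :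
    ∃ h : ℕ → ℕ, h 0 = 1 ∧
      ∀ k : ℕ, (properColoringCount G k : ℤ) =
        ∑ i ∈ Finset.range n, (-1 : ℤ) ^ i * (h i : ℤ) * (k : ℤ) * ((k : ℤ) - 1) ^ (n - 1 - i) := by
  subst hn
  obtain ⟨m, hm⟩ := Nat.exists_eq_add_of_le' hn1
  rw [hm]
  exact hG.hasHExpansion (Nat.card_eq_fintype_card.trans hm)
end

section
/- Let G be a finite simple graph on vertex set V and let k be a natural number. Then, as integers, P(G,k) = Σ_{s ⊆ E(G)} (-1)^{|s|} · k^{c(s)}, where the sum is over all subsets s of the edge set of G and c(s) denotes the number of connected components of the spanning subgraph of G with vertex set V and edge set s. -/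
/-- Functions on the vertices that are constant along edges are the same as functions on the
connected components. -/
def SimpleGraph.constOnAdjEquiv {V : Type*} (H : SimpleGraph V) (α : Type*) :
    {f : V → α // ∀ a b, H.Adj a b → f a = f b} ≃ (H.ConnectedComponent → α) where
  toFun f := SimpleGraph.ConnectedComponent.lift f.1 fun _ _ p _ => by
    induction p with
    | nil => rfl
    | cons h _ ih => exact (f.2 _ _ h).trans (ih (by simp_all))
  invFun g := ⟨fun v => g (H.connectedComponentMk v), fun _ _ h =>
    congrArg g (SimpleGraph.ConnectedComponent.sound h.reachable)⟩
  left_inv _ := rfl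
  right_inv g := by
    funext c
    induction c using SimpleGraph.ConnectedComponent.ind
    rfl

theorem SimpleGraph.card_constOnAdj {V : Type*} [Finite V] (H : SimpleGraph V) (k : ℕ) :
    Nat.card {f : V → Fin k // ∀ a b, H.Adj a b → f a = f b} =
      k ^ Nat.card H.ConnectedComponent := by
  rw [Nat.card_congr (H.constOnAdjEquiv (Fin k)), Nat.card_fun, Nat.card_fin]

/-- A function is constant along the edges in `s` iff it maps every element of `s` to the
diagonal. -/
theorem SimpleGraph.fromEdgeSet_constOnAdj_iff {V α : Type*} (s : Set (Sym2 V)) (f : V → α) :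
    (∀ a b, (SimpleGraph.fromEdgeSet s).Adj a b → f a = f b) ↔
      ∀ e ∈ s, (e.map f).IsDiag := by
  constructor
  · intro h e he
    induction e using Sym2.ind with
    | _ a b =>
      by_cases hab : a = b
      · simp [hab]
      · simpa using h a b (by simp [he, hab])
  · intro h a b hab
    simpa using h s(a, b) (SimpleGraph.fromEdgeSet_adj s |>.1 hab).1

/-- The state-sum (Whitney rank) expansion of the chromatic polynomial:
`P(G,k) = ∑_{s ⊆ E(G)} (-1)^{|s|} k^{c(s)}`, where `c(s)` is the number of connected
components of the spanning subgraph of `G` with edge set `s`. -/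
theorem state_sum_expansion {V : Type*} [Fintype V] [DecidableEq V]
    (G : SimpleGraph V) [DecidableRel G.Adj] (k : ℕ) :
    (properColoringCount G k : ℤ) =
      ∑ s ∈ G.edgeFinset.powerset,
        (-1 : ℤ) ^ s.card *
          (k : ℤ) ^ Nat.card (SimpleGraph.fromEdgeSet (s : Set (Sym2 V))).ConnectedComponent := by
  classical
  have hcard (p : (V → Fin k) → Prop) :
      (Nat.card {f // p f} : ℤ) = ∑ f, if p f then 1 else 0 := by
    simp [Nat.card_eq_fintype_card, Fintype.card_subtype]
  have hproper (f : V → Fin k) : (∀ a b, G.Adj a b → f a ≠ f b) ↔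
      G.edgeFinset.filter (fun e => (e.map f).IsDiag) = ∅ := by
    simp [Finset.filter_eq_empty_iff, Sym2.forall]
  have hpowerset (f : V → Fin k) :
      G.edgeFinset.powerset.filter (fun s => ∀ e ∈ s, (e.map f).IsDiag) =
        (G.edgeFinset.filter fun e => (e.map f).IsDiag).powerset := by
    ext s
    simp only [Finset.mem_filter, Finset.mem_powerset, Finset.subset_iff]
    grind
  simp_rw [← Nat.cast_pow, ← SimpleGraph.card_constOnAdj, hcard,
    SimpleGraph.fromEdgeSet_constOnAdj_iff, Finset.mem_coe, Finset.mul_sum, mul_ite, mul_one,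
    mul_zero]
  rw [properColoringCount, hcard, Finset.sum_comm]
  refine Finset.sum_congr rfl fun f _ => ?_
  rw [← Finset.sum_filter, hpowerset, Finset.sum_powerset_neg_one_pow_card]
  simp only [hproper]
end

section
/- Let V be a finite vertex set, let u ≠ v be two vertices, and let A, B be subsets of V with A ∪ B = V and A ∩ B = {u, v}. Let G and G' be simple graphs on V such that: every edge of G and every edge of G' has both endpoints in A or both endpoints in B; for all x, y ∈ A, x and y are adjacent in G if and only if they are adjacent in G'; and for all x, y ∈ B, x and y are adjacent in G' if and only if σ(x) and σ(y) are adjacent in G, where σ is the transposition of V exchanging u and v and fixing all other vertices. Then for every natural number k, P(G,k) = P(G',k). -/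
open Classical in
/-- Exchange the colors of `u` and `v` on all vertices outside `A`. -/
noncomputable def twistColoring {V : Type*} {k : ℕ} (u v : V) (A : Set V) (f : V → Fin k) :
    V → Fin k :=
  fun x => if x ∈ A then f x else Equiv.swap (f u) (f v) (f x)

lemma twistColoring_of_mem {V : Type*} {k : ℕ} {u v x : V} {A : Set V} (f : V → Fin k)
    (hx : x ∈ A) : twistColoring u v A f x = f x :=
  if_pos hx

lemma twistColoring_of_notMem {V : Type*} {k : ℕ} {u v x : V} {A : Set V} (f : V → Fin k)
    (hx : x ∉ A) : twistColoring u v A f x = Equiv.swap (f u) (f v) (f x) :=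
  if_neg hx

lemma twistColoring_twistColoring {V : Type*} {k : ℕ} {u v : V} {A : Set V}
    (hu : u ∈ A) (hv : v ∈ A) (f : V → Fin k) :
    twistColoring u v A (twistColoring u v A f) = f := by
  funext x
  by_cases hx : x ∈ A
  · rw [twistColoring_of_mem _ hx, twistColoring_of_mem _ hx]
  · rw [twistColoring_of_notMem _ hx, twistColoring_of_notMem _ hx, twistColoring_of_mem _ hu,
      twistColoring_of_mem _ hv, Equiv.swap_apply_self]

lemma twistColoring_eq_swap {V : Type*} [DecidableEq V] {k : ℕ} {u v x : V} {A B : Set V}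
    (hI : A ∩ B = {u, v}) (f : V → Fin k) (hx : x ∈ B) :
    twistColoring u v A f x = Equiv.swap (f u) (f v) (f (Equiv.swap u v x)) := by
  have hmem : ∀ y, y ∈ A ∧ y ∈ B ↔ y = u ∨ y = v := fun y => Set.ext_iff.1 hI y
  by_cases hxA : x ∈ A
  · rw [twistColoring_of_mem _ hxA]
    rcases (hmem x).1 ⟨hxA, hx⟩ with rfl | rfl <;> simp
  · have hxu : x ≠ u := fun h => hxA ((hmem x).2 (Or.inl h)).1
    have hxv : x ≠ v := fun h => hxA ((hmem x).2 (Or.inr h)).1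
    rw [twistColoring_of_notMem _ hxA, Equiv.swap_apply_of_ne_of_ne hxu hxv]

lemma twistColoring_proper {V : Type*} [DecidableEq V] {G G' : SimpleGraph V} {u v : V}
    {A B : Set V} (hI : A ∩ B = {u, v})
    (hEG' : ∀ x y, G'.Adj x y → (x ∈ A ∧ y ∈ A) ∨ (x ∈ B ∧ y ∈ B))
    (hA : ∀ x ∈ A, ∀ y ∈ A, G'.Adj x y → G.Adj x y)
    (hB : ∀ x ∈ B, ∀ y ∈ B, G'.Adj x y → G.Adj (Equiv.swap u v x) (Equiv.swap u v y))
    {k : ℕ} {f : V → Fin k} (hf : ∀ a b, G.Adj a b → f a ≠ f b) (a b : V) (hab : G'.Adj a b) :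
    twistColoring u v A f a ≠ twistColoring u v A f b := by
  rcases hEG' a b hab with ⟨ha, hb⟩ | ⟨ha, hb⟩
  · rw [twistColoring_of_mem _ ha, twistColoring_of_mem _ hb]
    exact hf a b (hA a ha b hb hab)
  · rw [twistColoring_eq_swap hI f ha, twistColoring_eq_swap hI f hb]
    exact (Equiv.injective _).ne (hf _ _ (hB a ha b hb hab))

/-- Invariance of the chromatic polynomial under a Whitney twist: if `G'` is
obtained from `G` by regluing the part of `G` inside `B` to the part inside `A`
along the 2-element cut `{u, v}` after exchanging the roles of `u` and `v`,
then `P(G,k) = P(G',k)` for every `k`. -/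
theorem chromatic_whitney_twist {V : Type*} [Fintype V] [DecidableEq V]
    (G G' : SimpleGraph V) (u v : V) (huv : u ≠ v) (A B : Set V)
    (hU : A ∪ B = Set.univ) (hI : A ∩ B = {u, v})
    (hEG : ∀ x y, G.Adj x y → (x ∈ A ∧ y ∈ A) ∨ (x ∈ B ∧ y ∈ B))
    (hEG' : ∀ x y, G'.Adj x y → (x ∈ A ∧ y ∈ A) ∨ (x ∈ B ∧ y ∈ B))
    (hA : ∀ x ∈ A, ∀ y ∈ A, (G.Adj x y ↔ G'.Adj x y))
    (hB : ∀ x ∈ B, ∀ y ∈ B,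
      (G'.Adj x y ↔ G.Adj (Equiv.swap u v x) (Equiv.swap u v y)))
    (k : ℕ) :
    properColoringCount G k = properColoringCount G' k := by
  have hmem : ∀ y, y ∈ A ∧ y ∈ B ↔ y = u ∨ y = v := fun y => Set.ext_iff.1 hI y
  obtain ⟨huA, huB⟩ := (hmem u).2 (Or.inl rfl)
  obtain ⟨hvA, hvB⟩ := (hmem v).2 (Or.inr rfl)
  have hswap : ∀ x ∈ B, Equiv.swap u v x ∈ B := by
    intro x hx
    rw [Equiv.swap_apply_def]
    split_ifs <;> assumption
  have hB' : ∀ x ∈ B, ∀ y ∈ B, G.Adj x y → G'.Adj (Equiv.swap u v x) (Equiv.swap u v y) := by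
    intro x hx y hy hxy
    rw [hB _ (hswap x hx) _ (hswap y hy), Equiv.swap_apply_self, Equiv.swap_apply_self]
    exact hxy
  exact Nat.card_congr
    { toFun := fun f => ⟨twistColoring u v A f.1, twistColoring_proper hI hEG'
        (fun x hx y hy => (hA x hx y hy).2) (fun x hx y hy => (hB x hx y hy).1) f.2⟩
      invFun := fun f => ⟨twistColoring u v A f.1, twistColoring_proper hI hEG
        (fun x hx y hy => (hA x hx y hy).1) hB' f.2⟩
      left_inv := fun f => Subtype.ext (twistColoring_twistColoring huA hvA f.1)
      right_inv := fun f => Subtype.ext (twistColoring_twistColoring huA hvA f.1) }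
end

section
/- Let G be a finite simple graph on n vertices. Then there exists a monic polynomial p with integer coefficients of degree n such that for every natural number k, the evaluation of p at k equals P(G,k). -/
/-- Every proper coloring factors uniquely as the quotient by a partition of the vertices into
independent sets followed by an injection of the parts into the colors. -/
noncomputable def properColoringEquiv {V : Type*} (G : SimpleGraph V) (k : ℕ) :
    (Σ r : {r : Setoid V // ∀ a b, G.Adj a b → ¬ r a b}, Quotient r.1 ↪ Fin k) ≃
      {f : V → Fin k // ∀ a b, G.Adj a b → f a ≠ f b} :=
  Equiv.ofBijective
    (fun x => ⟨fun v => x.2 (Quotient.mk x.1.1 v), fun a b hab h =>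
      x.1.2 a b hab (Quotient.exact (x.2.injective h))⟩) <| by
    constructor
    · rintro ⟨⟨r, hr⟩, e⟩ ⟨⟨s, hs⟩, d⟩ h
      have hfun : ∀ v, e (Quotient.mk r v) = d (Quotient.mk s v) :=
        congrFun (congrArg Subtype.val h)
      obtain rfl : r = s := Setoid.ext fun a b => by
        rw [← Quotient.eq (r := r), ← Quotient.eq (r := s), ← e.injective.eq_iff, hfun, hfun,
          d.injective.eq_iff]
      obtain rfl : e = d := DFunLike.ext _ _ fun q => Quotient.inductionOn q hfun
      rfl
    · rintro ⟨f, hf⟩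
      exact ⟨⟨⟨Setoid.ker f, hf⟩, Setoid.kerLift f, Setoid.kerLift_injective f⟩, rfl⟩

theorem Setoid.card_quotient_lt {V : Type*} [Finite V] {r : Setoid V} (hr : r ≠ ⊥) :
    Nat.card (Quotient r) < Nat.card V := by
  refine lt_of_le_of_ne (Nat.card_le_card_of_surjective _ Quotient.mk_surjective) fun h => hr ?_
  have hbij := Quotient.mk_surjective.bijective_of_nat_card_le h.ge
  exact Setoid.ext fun a b => by
    rw [← Quotient.eq (r := r), hbij.1.eq_iff, Setoid.bot_def]

/-- There is a monic integer polynomial of degree `n` (the chromatic polynomial)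
whose value at every natural number `k` is the number of proper `k`-colorings. -/
theorem exists_chromatic_polynomial {V : Type*} [Fintype V] (G : SimpleGraph V)
    (n : ℕ) (hn : n = Fintype.card V) :
    ∃ p : Polynomial ℤ, p.Monic ∧ p.natDegree = n ∧
      ∀ k : ℕ, p.eval (k : ℤ) = (properColoringCount G k : ℤ) := by
  classical
  have : Finite (Setoid V) :=
    Finite.of_injective (fun r : Setoid V => (r : V → V → Prop)) fun r s h =>
      Setoid.ext fun a b => iff_of_eq (congrFun₂ h a b)
  have := Fintype.ofFinite {r : Setoid V // ∀ a b, G.Adj a b → ¬ r a b}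
  let bot : {r : Setoid V // ∀ a b, G.Adj a b → ¬ r a b} := ⟨⊥, fun a b hab => hab.ne⟩
  let partPoly (r : {r : Setoid V // ∀ a b, G.Adj a b → ¬ r a b}) : Polynomial ℤ :=
    descPochhammer ℤ (Nat.card (Quotient r.1))
  have hbot : Nat.card (Quotient bot.1) = n := by
    rw [hn, ← Nat.card_eq_fintype_card]
    exact (Nat.card_eq_of_bijective (Quotient.mk bot.1)
      ⟨fun a b h => Quotient.exact h, Quotient.mk_surjective⟩).symm
  have hdeg : (partPoly bot).degree = n := by
    rw [Polynomial.degree_eq_natDegree (monic_descPochhammer ℤ _).ne_zero,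
      descPochhammer_natDegree, hbot]
  have hlt : (∑ r ∈ Finset.univ.erase bot, partPoly r).degree < (partPoly bot).degree := by
    rw [hdeg, ← Polynomial.mem_degreeLT]
    refine Submodule.sum_mem _ fun r hr => Polynomial.mem_degreeLT.2 ?_
    rw [Polynomial.degree_eq_natDegree (monic_descPochhammer ℤ _).ne_zero,
      descPochhammer_natDegree, hn, ← Nat.card_eq_fintype_card]
    exact_mod_cast Setoid.card_quotient_lt fun h => Finset.ne_of_mem_erase hr (Subtype.ext h)
  refine ⟨∑ r, partPoly r, ?_, ?_, fun k => ?_⟩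
  · rw [← Finset.add_sum_erase _ _ (Finset.mem_univ bot)]
    exact (monic_descPochhammer ℤ _).add_of_left hlt
  · rw [← Finset.add_sum_erase _ _ (Finset.mem_univ bot)]
    refine Polynomial.natDegree_eq_of_degree_eq_some ?_
    rw [Polynomial.degree_add_eq_left_of_degree_lt hlt, hdeg]
  · rw [properColoringCount, ← Nat.card_congr (properColoringEquiv G k), Nat.card_sigma,
      Polynomial.eval_finsetSum, Nat.cast_sum]
    refine Finset.sum_congr rfl fun r _ => ?_
    rw [descPochhammer_eval_eq_descFactorial, Nat.card_eq_fintype_card,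
      Nat.card_eq_fintype_card, Fintype.card_embedding_eq, Fintype.card_fin]
end

section
/- Let G be a connected finite simple graph on n ≥ 1 vertices and let p be a polynomial with integer coefficients such that for every natural number k, the evaluation of p at k equals P(G,k). Then the coefficients of p alternate in sign: for every 0 ≤ i ≤ n, (−1)^{n−i} times the coefficient of X^i in p is nonnegative. -/
/-- The number of proper `k`-colorings of the multigraph with vertex set `V` and edge list `E`,
in which loops and parallel edges are allowed. -/
noncomputable def edgeListColoringCount {V : Type*} (E : List (V × V)) (k : ℕ) : ℕ :=
  Nat.card {f : V → Fin k // ∀ e ∈ E, f e.1 ≠ f e.2}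

open Classical in
/-- The map that contracts the vertex `a` onto a different vertex `b`. -/
noncomputable def contractVertex {V : Type*} {a b : V} (hab : a ≠ b) (v : V) : {v : V // v ≠ a} :=
  if h : v = a then ⟨b, hab.symm⟩ else ⟨v, h⟩

/-- Colorings giving `a` and `b` the same color correspond to colorings of the contraction. -/
noncomputable def contractColoringEquiv {V : Type*} {a b : V} (hab : a ≠ b) (E : List (V × V))
    (k : ℕ) : {f : V → Fin k // (∀ e ∈ E, f e.1 ≠ f e.2) ∧ f a = f b} ≃
      {g : {v : V // v ≠ a} → Fin k //
        ∀ e ∈ E.map (Prod.map (contractVertex hab) (contractVertex hab)), g e.1 ≠ g e.2} :=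
  have lift_eq (f : V → Fin k) (hf : f a = f b) (v : V) : f (contractVertex hab v) = f v := by
    unfold contractVertex
    split_ifs with h
    · rw [h, hf]
    · rfl
  { toFun f := ⟨fun v => f.1 v, by
      intro e he
      obtain ⟨e', he', rfl⟩ := List.mem_map.1 he
      simpa only [Prod.map_fst, Prod.map_snd, lift_eq f.1 f.2.2] using f.2.1 e' he'⟩
    invFun g := ⟨fun v => g.1 (contractVertex hab v),
      fun e he => g.2 _ (List.mem_map_of_mem he), by simp [contractVertex, hab.symm]⟩
    left_inv f := Subtype.ext (funext (lift_eq f.1 f.2.2))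
    right_inv g := Subtype.ext (funext fun v => by simp [contractVertex, v.2]) }

theorem edgeListColoringCount_deletion_contraction {V : Type*} [Finite V] {a b : V} (hab : a ≠ b)
    (E : List (V × V)) (k : ℕ) :
    edgeListColoringCount E k = edgeListColoringCount ((a, b) :: E) k +
      edgeListColoringCount (E.map (Prod.map (contractVertex hab) (contractVertex hab))) k := by
  classical
  have := Fintype.ofFinite V
  simp only [edgeListColoringCount]
  rw [← Nat.card_congr (contractColoringEquiv hab E k)]
  simp only [Nat.card_eq_fintype_card, Fintype.card_subtype, List.forall_mem_cons]
  rw [← Finset.card_filter_add_card_filter_not (fun f : V → Fin k => f a ≠ f b),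
    Finset.filter_filter, Finset.filter_filter]
  simp only [not_not, and_comm]

theorem exists_alternating_polynomial_edgeListColoringCount {V : Type*} [Finite V]
    (E : List (V × V)) : ∃ q : Polynomial ℤ,
      (∀ k : ℕ, q.eval (k : ℤ) = (edgeListColoringCount E k : ℤ)) ∧
      ∀ i, 0 ≤ (-1 : ℤ) ^ (Nat.card V + i) * q.coeff i := by
  induction hE : E.length generalizing V with
  | zero =>
    obtain rfl := List.length_eq_zero_iff.1 hE
    refine ⟨Polynomial.X ^ Nat.card V, fun k => ?_, fun i => ?_⟩
    · simp [edgeListColoringCount, Nat.card_fun]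
    · rw [Polynomial.coeff_X_pow]
      split_ifs with h
      · simp [h, ← two_mul]
      · simp
  | succ m ih =>
    obtain ⟨⟨a, b⟩, E, rfl⟩ := List.exists_cons_of_length_eq_add_one hE
    have hlen : E.length = m := by simpa using hE
    by_cases hab : a = b
    · refine ⟨0, fun k => ?_, by simp⟩
      simp [edgeListColoringCount, hab]
    · obtain ⟨q, hq, hq_sign⟩ := ih E hlen
      obtain ⟨r, hr, hr_sign⟩ :=
        ih (E.map (Prod.map (contractVertex hab) (contractVertex hab))) (by simpa using hlen)
      refine ⟨q - r, fun k => ?_, fun i => ?_⟩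
      · rw [Polynomial.eval_sub, hq, hr, edgeListColoringCount_deletion_contraction hab]
        push_cast
        ring
      · have hcard : Nat.card V = Nat.card {v : V // v ≠ a} + 1 := by
          classical
          have := Fintype.ofFinite V
          have := Fintype.card_pos_iff.2 ⟨a⟩
          simp only [Nat.card_eq_fintype_card, Fintype.card_subtype_compl, ne_eq,
            Fintype.card_subtype_eq]
          omega
        have hq_i := hq_sign i
        have hr_i := hr_sign i
        rw [Polynomial.coeff_sub, mul_sub]
        rw [hcard, add_right_comm, pow_succ] at hq_i ⊢
        linarith

/-- The coefficients of the chromatic polynomial of a connected graph on `n ≥ 1`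
vertices alternate in sign: `(−1)^{n−i} · (coefficient of Xⁱ) ≥ 0` for `0 ≤ i ≤ n`. -/
theorem chromatic_coefficients_alternate {V : Type*} [Fintype V] (G : SimpleGraph V)
    (hG : G.Connected) (n : ℕ) (hn : n = Fintype.card V) (hn1 : 1 ≤ n)
    (p : Polynomial ℤ) (hp : ∀ k : ℕ, p.eval (k : ℤ) = (properColoringCount G k : ℤ)) :
    ∀ i ≤ n, 0 ≤ (-1 : ℤ) ^ (n - i) * p.coeff i := by
  classical
  intro i hi
  obtain ⟨q, hq, hq_sign⟩ := exists_alternating_polynomial_edgeListColoringCount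
    ({e : V × V | G.Adj e.1 e.2} : Finset (V × V)).toList
  have hpq : p = q := by
    refine Polynomial.eq_of_infinite_eval_eq p q
      ((Set.infinite_range_of_injective (Nat.cast_injective (R := ℤ))).mono ?_)
    rintro _ ⟨k, rfl⟩
    rw [Set.mem_ofPred_eq, hp, hq]
    simp [properColoringCount, edgeListColoringCount]
  have hsign := hq_sign i
  rw [Nat.card_eq_fintype_card, ← hn] at hsign
  have hpow : (-1 : ℤ) ^ (n + i) = (-1) ^ (n - i) := by
    rw [show n + i = n - i + 2 * i by omega, pow_add, pow_mul]
    simp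
  rwa [hpow, ← hpq] at hsign
end
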